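/- For f : (C²,0) → (C⁴,0) given by f(x,y) = (x², y², x³ + xy, y³ + xy), the double point space D^2(f) = V(I^2(f)) has dimension 0 but embedding dimension 4; consequently D^2(f) is a non-reduced scheme. -/

import Mathlib

open Filter Topology

/-- The local ring of germs at `z` of complex-analytic functions, as a subring of the
ring of germs of all functions at `z`. -/
noncomputable def analyticGerms (E : Type*) [NormedAddCommGroup E] [NormedSpace ℂ E]
    (z : E) : Subring (Filter.Germ (nhds z) ℂ) where
  carrier := {γ | ∃ g : E → ℂ, AnalyticAt ℂ g z ∧ γ = (g : Filter.Germ (nhds z) ℂ)}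
  mul_mem' := by rintro a b ⟨g, hg, rfl⟩ ⟨h, hh, rfl⟩; exact ⟨g * h, hg.mul hh, rfl⟩
  one_mem' := ⟨1, analyticAt_const, rfl⟩
  add_mem' := by rintro a b ⟨g, hg, rfl⟩ ⟨h, hh, rfl⟩; exact ⟨g + h, hg.add hh, rfl⟩
  zero_mem' := ⟨0, analyticAt_const, rfl⟩
  neg_mem' := by rintro a ⟨g, hg, rfl⟩; exact ⟨-g, hg.neg, rfl⟩

/-- Mond's double point ideal `I²(f)` in the local ring `O_{2n}` of holomorphic germs at
the origin of `ℂⁿ × ℂⁿ`, formed from a matrix `α` with `f(x)-f(x') = α(x,x')(x-x')`: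
it is generated by the germs of the components `fⱼ(x) - fⱼ(x')` together with the
`n × n` minors of `α`. -/
noncomputable def mondDoubleIdeal (n p : ℕ) (f : (Fin n → ℂ) → (Fin p → ℂ))
    (α : Fin p → Fin n → ((Fin n → ℂ) × (Fin n → ℂ)) → ℂ) :
    Ideal (analyticGerms ((Fin n → ℂ) × (Fin n → ℂ)) (0, 0)) :=
  Ideal.span
    ({γ | ∃ j : Fin p, (γ : Filter.Germ (nhds ((0, 0) : (Fin n → ℂ) × (Fin n → ℂ))) ℂ)
          = ((fun w : (Fin n → ℂ) × (Fin n → ℂ) => f w.1 j - f w.2 j) : Filter.Germ (nhds ((0, 0) : (Fin n → ℂ) × (Fin n → ℂ))) ℂ)}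
      ∪ {γ | ∃ rows : Fin n → Fin p, StrictMono rows ∧
          (γ : Filter.Germ (nhds ((0, 0) : (Fin n → ℂ) × (Fin n → ℂ))) ℂ)
          = ((fun w : (Fin n → ℂ) × (Fin n → ℂ) => (Matrix.of fun i i' : Fin n => α (rows i) i' w).det) :
              Filter.Germ (nhds ((0, 0) : (Fin n → ℂ) × (Fin n → ℂ))) ℂ)})


/-- The space of linear parts at the origin of the elements of an ideal `I` of the ring
`O_{2n}` of analytic germs: the span of the differentials at the base point of analytic
representatives of members of `I`. The embedding dimension of `V(I)` is `2n` minus its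
dimension. -/
noncomputable def linearParts (n : ℕ)
    (I : Ideal (analyticGerms ((Fin n → ℂ) × (Fin n → ℂ)) (0, 0))) :
    Submodule ℂ (((Fin n → ℂ) × (Fin n → ℂ)) →L[ℂ] ℂ) :=
  Submodule.span ℂ {L | ∃ γ ∈ I, ∃ g : ((Fin n → ℂ) × (Fin n → ℂ)) → ℂ,
    AnalyticAt ℂ g (0, 0) ∧
    (γ : Filter.Germ (nhds ((0, 0) : (Fin n → ℂ) × (Fin n → ℂ))) ℂ)
      = (g : Filter.Germ (nhds ((0, 0) : (Fin n → ℂ) × (Fin n → ℂ))) ℂ) ∧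
    L = fderiv ℂ g (0, 0)}


/-- Hadamard's lemma: an analytic function is, near the base point, its value there plus an
analytic family of linear forms evaluated on the displacement. -/
lemma AnalyticAt.exists_eq_add_apply_sub {E : Type*} [NormedAddCommGroup E] [NormedSpace ℂ E]
    {z : E} {g : E → ℂ} (hg : AnalyticAt ℂ g z) :
    ∃ h : E → E →L[ℂ] ℂ, AnalyticAt ℂ h z ∧ ∀ᶠ w in 𝓝 z, g w = g z + h w (w - z) := by
  obtain ⟨p, r, hp⟩ := hg
  have hpos : 0 < p.shift.radius := by
    rw [FormalMultilinearSeries.radius_shift]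
    exact hp.r_pos.trans_le hp.r_le
  have hs := (p.shift.hasFPowerSeriesOnBall hpos).comp_sub z
  rw [zero_add] at hs
  refine ⟨fun w => p.shift.sum (w - z), hs.analyticAt, ?_⟩
  have hu := hs.unshift (z := g z)
  have hpp : p.shift.unshift (g z) = p := by
    ext1 n
    cases n with
    | zero =>
      ext v
      simp [FormalMultilinearSeries.unshift, hp.coeff_zero]
    | succ n =>
      exact LinearIsometryEquiv.symm_apply_apply (continuousMultilinearCurryRightEquiv' ℂ n E ℂ) _
  rw [hpp] at hu
  have hr := lt_min hp.r_pos hpos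
  exact ((hp.mono hr (min_le_left _ _)).unique (hu.mono hr (min_le_right _ _))).eventuallyEq_of_mem
    (Metric.eball_mem_nhds z hr)

section Algebra

variable {A : Type*} [CommRing A]

/-- If a product of two factors is replaced by congruent factors modulo `Q + 𝔪²`, all factors
lying in `𝔪`, the product changes by an element of `Q + 𝔪³`. -/
lemma mul_sub_mul_mem_sup_pow_three {m Q : Ideal A} {a b a' b' : A}
    (hb : b ∈ m) (ha' : a' ∈ m) (h1 : a - a' ∈ Q ⊔ m ^ 2) (h2 : b - b' ∈ Q ⊔ m ^ 2) :
    a * b - a' * b' ∈ Q ⊔ m ^ 3 := by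
  have key : ∀ c ∈ Q ⊔ m ^ 2, ∀ d ∈ m, c * d ∈ Q ⊔ m ^ 3 := by
    intro c hc d hd
    obtain ⟨q, hq, s, hs, rfl⟩ := Submodule.mem_sup.1 hc
    rw [add_mul]
    refine add_mem (Ideal.mem_sup_left (Q.mul_mem_right _ hq)) (Ideal.mem_sup_right ?_)
    rw [pow_succ]
    exact Ideal.mul_mem_mul hs hd
  have : a * b - a' * b' = (a - a') * b + (b - b') * a' := by ring
  rw [this]
  exact add_mem (key _ h1 _ hb) (key _ h2 _ ha')

lemma sq_le_sup_sq {m P J : Ideal A} (h : m ≤ P ⊔ J) : m ^ 2 ≤ P ⊔ J ^ 2 := by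
  rw [pow_two, Ideal.mul_le]
  intro a ha b hb
  obtain ⟨p, hp, j, hj, rfl⟩ := Submodule.mem_sup.1 (h ha)
  obtain ⟨q, hq, k, hk, rfl⟩ := Submodule.mem_sup.1 (h hb)
  have : (p + j) * (q + k) = (p * (q + k) + j * q) + j * k := by ring
  rw [this]
  refine add_mem (Ideal.mem_sup_left (add_mem (P.mul_mem_right _ hp) (P.mul_mem_left _ hq)))
    (Ideal.mem_sup_right ?_)
  rw [pow_two]
  exact Ideal.mul_mem_mul hj hk

/-- The zero locus of the differences `f_j(x, y) - f_j(x', y')` lies in the diagonal, for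
`f(x, y) = (x², y², x³ + xy, y³ + xy)`. -/
lemma sub_mem_of_differences_mem {P : Ideal A} [P.IsPrime] (h2 : IsUnit (2 : A)) {x y x' y' : A}
    (h₁ : x ^ 2 - x' ^ 2 ∈ P) (h₂ : y ^ 2 - y' ^ 2 ∈ P)
    (h₃ : (x ^ 3 + x * y) - (x' ^ 3 + x' * y') ∈ P)
    (h₄ : (y ^ 3 + x * y) - (y' ^ 3 + x' * y') ∈ P) : x - x' ∈ P ∧ y - y' ∈ P := by
  have two : (2 : A ⧸ P) ≠ 0 := by
    have := (h2.map (Ideal.Quotient.mk P)).ne_zero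
    rwa [map_ofNat] at this
  simp only [← Ideal.Quotient.eq_zero_iff_mem, map_sub, map_add, map_mul, map_pow] at *
  generalize Ideal.Quotient.mk P x = x at *
  generalize Ideal.Quotient.mk P y = y at *
  generalize Ideal.Quotient.mk P x' = x' at *
  generalize Ideal.Quotient.mk P y' = y' at *
  have e1 : (x - x') * (x + x') = 0 := by linear_combination h₁
  have e2 : (y - y') * (y + y') = 0 := by linear_combination h₂
  have aux : ∀ a : A ⧸ P, 2 * a = 0 → a = 0 := fun a ha => (mul_eq_zero.1 ha).resolve_left two
  rcases mul_eq_zero.1 e1 with hu | hx <;> rcases mul_eq_zero.1 e2 with hv | hy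
  · exact ⟨hu, hv⟩
  · obtain rfl : x = x' := sub_eq_zero.1 hu
    obtain rfl : y' = -y := by linear_combination hy
    have hxy : x * y = 0 := aux _ (by linear_combination h₃)
    have hy3 : y ^ 3 = 0 := aux _ (by linear_combination h₄ - 2 * hxy)
    have : y = 0 := pow_eq_zero_iff (three_ne_zero) |>.1 hy3
    simp [this]
  · obtain rfl : y = y' := sub_eq_zero.1 hv
    obtain rfl : x' = -x := by linear_combination hx
    have hxy : x * y = 0 := aux _ (by linear_combination h₄)
    have hx3 : x ^ 3 = 0 := aux _ (by linear_combination h₃ - 2 * hxy)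
    have : x = 0 := pow_eq_zero_iff (three_ne_zero) |>.1 hx3
    simp [this]
  · obtain rfl : y' = -y := by linear_combination hy
    obtain rfl : x' = -x := by linear_combination hx
    have hx3 : x ^ 3 = 0 := aux _ (by linear_combination h₃)
    have hy3 : y ^ 3 = 0 := aux _ (by linear_combination h₄)
    have hx0 : x = 0 := pow_eq_zero_iff (three_ne_zero) |>.1 hx3
    have hy0 : y = 0 := pow_eq_zero_iff (three_ne_zero) |>.1 hy3
    simp [hx0, hy0]

/-- A prime containing the differences `f_j(x, y) - f_j(x', y')` and the minors of a matrix that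
agrees with the Jacobian matrix of `f` up to `(x - x', y - y') + 𝔪²` contains `𝔪`. -/
lemma le_of_double_point_equations_mem {m P : Ideal A} [P.IsPrime] (hm : m ≤ Ideal.jacobson ⊥)
    (h2 : IsUnit (2 : A)) {x y x' y' : A} (hspan : m = Ideal.span {x, y, x', y'})
    (h₁ : x ^ 2 - x' ^ 2 ∈ P) (h₂ : y ^ 2 - y' ^ 2 ∈ P)
    (h₃ : (x ^ 3 + x * y) - (x' ^ 3 + x' * y') ∈ P)
    (h₄ : (y ^ 3 + x * y) - (y' ^ 3 + x' * y') ∈ P)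
    {a b c d e g : A}
    (ha : a - 2 * x ∈ Ideal.span {x - x', y - y'} ⊔ m ^ 2)
    (hb : b ∈ Ideal.span {x - x', y - y'} ⊔ m ^ 2)
    (hc : c ∈ Ideal.span {x - x', y - y'} ⊔ m ^ 2)
    (hd : d - 2 * y ∈ Ideal.span {x - x', y - y'} ⊔ m ^ 2)
    (he : e - y ∈ Ideal.span {x - x', y - y'} ⊔ m ^ 2)
    (hg : g - x ∈ Ideal.span {x - x', y - y'} ⊔ m ^ 2)
    (h12 : a * d - b * c ∈ P) (h13 : a * g - b * e ∈ P) (h23 : c * g - d * e ∈ P) :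
    m ≤ P := by
  obtain ⟨hu, hv⟩ := sub_mem_of_differences_mem h2 h₁ h₂ h₃ h₄
  have hx : x ∈ m := hspan ▸ Ideal.subset_span (by simp)
  have hy : y ∈ m := hspan ▸ Ideal.subset_span (by simp)
  have hx' : x' ∈ m := hspan ▸ Ideal.subset_span (by simp)
  have hy' : y' ∈ m := hspan ▸ Ideal.subset_span (by simp)
  have hJP : Ideal.span {x - x', y - y'} ⊔ m ^ 2 ≤ P ⊔ m ^ 2 := by
    refine sup_le_sup_right (Ideal.span_le.2 ?_) _
    rintro t (rfl | rfl) <;> assumption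
  have hJm : Ideal.span {x - x', y - y'} ⊔ m ^ 2 ≤ m := by
    refine sup_le (Ideal.span_le.2 ?_) (Ideal.pow_le_self two_ne_zero)
    rintro t (rfl | rfl)
    exacts [sub_mem hx hx', sub_mem hy hy']
  have h2x : 2 * x ∈ m := m.mul_mem_left _ hx
  have h2y : 2 * y ∈ m := m.mul_mem_left _ hy
  have hbm := hJm hb
  have hdm : d ∈ m := by simpa using add_mem (hJm hd) h2y
  have hem : e ∈ m := by simpa using add_mem (hJm he) hy
  have hgm : g ∈ m := by simpa using add_mem (hJm hg) hx
  have hcm := hJm hc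
  have hP : ∀ {t : A}, t ∈ P → t ∈ P ⊔ m ^ 3 := fun h => Ideal.mem_sup_left h
  have hb' : b - 0 ∈ P ⊔ m ^ 2 := by simpa using hJP hb
  have hc' : c - 0 ∈ P ⊔ m ^ 2 := by simpa using hJP hc
  obtain ⟨i, hi⟩ := h2.exists_left_inv
  have hxx : x * x ∈ P ⊔ m ^ 3 := by
    have k1 := mul_sub_mul_mem_sup_pow_three hgm h2x (hJP ha) (hJP hg)
    have k2 := mul_sub_mul_mem_sup_pow_three hem m.zero_mem hb' (hJP he)
    have k := Ideal.mul_mem_left _ i (sub_mem (sub_mem (hP h13) k1) (neg_mem k2))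
    convert k using 1
    linear_combination (-x * x) * hi
  have hyy : y * y ∈ P ⊔ m ^ 3 := by
    have k1 := mul_sub_mul_mem_sup_pow_three hgm m.zero_mem hc' (hJP hg)
    have k2 := mul_sub_mul_mem_sup_pow_three hem h2y (hJP hd) (hJP he)
    have k := Ideal.mul_mem_left _ i (sub_mem (sub_mem k1 k2) (hP h23))
    convert k using 1
    linear_combination (-y * y) * hi
  have hxy : x * y ∈ P ⊔ m ^ 3 := by
    have k1 := mul_sub_mul_mem_sup_pow_three hdm h2x (hJP ha) (hJP hd)
    have k2 := mul_sub_mul_mem_sup_pow_three hcm m.zero_mem hb' hc'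
    have k := Ideal.mul_mem_left _ (i * i) (sub_mem (sub_mem (hP h12) k1) (neg_mem k2))
    convert k using 1
    linear_combination (-x * y) * (2 * i + 1) * hi
  have hle : m ≤ P ⊔ Ideal.span {x, y} := by
    rw [hspan, Ideal.span_le]
    have hx1 : x ∈ P ⊔ Ideal.span {x, y} := Ideal.mem_sup_right (Ideal.subset_span (by simp))
    have hy1 : y ∈ P ⊔ Ideal.span {x, y} := Ideal.mem_sup_right (Ideal.subset_span (by simp))
    rintro t (rfl | rfl | rfl | rfl)
    · exact hx1
    · exact hy1
    · simpa using sub_mem hx1 (Ideal.mem_sup_left (T := Ideal.span {x, y}) hu)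
    · simpa using sub_mem hy1 (Ideal.mem_sup_left (T := Ideal.span {x, y}) hv)
  have hsq : m ^ 2 ≤ P ⊔ m • m ^ 2 := by
    rw [smul_eq_mul, ← pow_succ']
    refine (sq_le_sup_sq hle).trans (sup_le le_sup_left ?_)
    rw [pow_two, Ideal.span_mul_span', Ideal.span_le]
    rintro _ ⟨s, hs, t, ht, rfl⟩
    rcases hs with rfl | rfl <;> rcases ht with rfl | rfl
    exacts [hxx, hxy, by change _ * _ ∈ P ⊔ m ^ 3; rwa [mul_comm], hyy]
  have hfg : (m ^ 2).FG := by
    refine Ideal.FG.pow ?_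
    rw [hspan]
    exact Submodule.fg_span (by simp)
  have hm2 : m ^ 2 ≤ P := Submodule.le_of_le_smul_of_le_jacobson_bot hfg hm hsq
  exact (Ideal.IsPrime.pow_le_iff two_ne_zero).1 hm2

end Algebra

namespace analyticGerms

section General

variable {E : Type*} [NormedAddCommGroup E] [NormedSpace ℂ E] {z : E}

/-- The germ of a function analytic at `z`. -/
noncomputable def of (g : E → ℂ) (hg : AnalyticAt ℂ g z) : analyticGerms E z :=
  ⟨(g : Filter.Germ (nhds z) ℂ), g, hg, rfl⟩

lemma exists_of (γ : analyticGerms E z) : ∃ g, ∃ hg : AnalyticAt ℂ g z, γ = of g hg := by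
  obtain ⟨_, g, hg, rfl⟩ := γ
  exact ⟨g, hg, rfl⟩

lemma of_eq_of {g h : E → ℂ} {hg : AnalyticAt ℂ g z} {hh : AnalyticAt ℂ h z} :
    of g hg = of h hh ↔ g =ᶠ[𝓝 z] h :=
  Subtype.ext_iff.trans Filter.Germ.coe_eq

variable (E z) in
/-- Evaluation of germs at the base point. -/
noncomputable def eval : analyticGerms E z →+* ℂ :=
  Filter.Germ.valueRingHom.comp (analyticGerms E z).subtype

@[simp] lemma eval_of (g : E → ℂ) (hg : AnalyticAt ℂ g z) : eval E z (of g hg) = g z := rfl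

lemma isUnit_of_eval_ne_zero {γ : analyticGerms E z} (h : eval E z γ ≠ 0) : IsUnit γ := by
  obtain ⟨g, hg, rfl⟩ := exists_of γ
  rw [eval_of] at h
  refine IsUnit.of_mul_eq_one (of (fun w => (g w)⁻¹) (hg.fun_inv h)) (of_eq_of (hg := ?_)
    (hh := analyticAt_const (v := (1 : ℂ))) |>.2 ?_)
  · exact hg.mul (hg.fun_inv h)
  · filter_upwards [hg.continuousAt.eventually_ne h] with w hw
    exact mul_inv_cancel₀ hw

lemma eval_surjective : Function.Surjective (eval E z) := fun c =>
  ⟨of (fun _ => c) analyticAt_const, rfl⟩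

lemma isMaximal_ker_eval : (RingHom.ker (eval E z)).IsMaximal :=
  RingHom.ker_isMaximal_of_surjective _ eval_surjective

lemma le_ker_eval {I : Ideal (analyticGerms E z)} (hI : I ≠ ⊤) : I ≤ RingHom.ker (eval E z) := by
  intro γ hγ
  by_contra h
  exact hI (I.eq_top_of_isUnit_mem hγ (isUnit_of_eval_ne_zero h))

lemma ker_eval_le_jacobson : RingHom.ker (eval E z) ≤ Ideal.jacobson ⊥ := by
  intro γ hγ
  rw [Ideal.mem_jacobson_bot]
  intro δ
  apply isUnit_of_eval_ne_zero
  simp [RingHom.mem_ker.1 hγ]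

/-- The elements of `𝔪²` have vanishing differential. -/
lemma fderiv_eq_zero_of_mem_sq {γ : analyticGerms E z} (h : γ ∈ RingHom.ker (eval E z) ^ 2)
    {g : E → ℂ} (hγ : (γ : Filter.Germ (nhds z) ℂ) = (g : Filter.Germ (nhds z) ℂ)) :
    fderiv ℂ g z = 0 := by
  suffices H : ∃ g : E → ℂ, (γ : Filter.Germ (nhds z) ℂ) = (g : Filter.Germ (nhds z) ℂ) ∧
      HasFDerivAt g (0 : E →L[ℂ] ℂ) z by
    obtain ⟨k, hk, hd⟩ := H
    have : g =ᶠ[𝓝 z] k := Filter.Germ.coe_eq.1 (hγ.symm.trans hk)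
    rw [this.fderiv_eq, hd.fderiv]
  clear hγ g
  rw [pow_two] at h
  induction h using Submodule.mul_induction_on' with
  | mem_mul_mem a ha b hb =>
    obtain ⟨g, hg, rfl⟩ := exists_of a
    obtain ⟨k, hk, rfl⟩ := exists_of b
    have hg0 : g z = 0 := ha
    have hk0 : k z = 0 := hb
    refine ⟨g * k, rfl, ?_⟩
    have := hg.differentiableAt.hasFDerivAt.mul hk.differentiableAt.hasFDerivAt
    refine this.congr_fderiv ?_
    ext v
    simp [hg0, hk0]
  | add a _ b _ iha ihb =>
    obtain ⟨g, hg, hg'⟩ := iha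
    obtain ⟨k, hk, hk'⟩ := ihb
    refine ⟨g + k, ?_, by simpa using hg'.add hk'⟩
    rw [Subring.coe_add, hg, hk]
    rfl

end General

section Plane

lemma analyticAt_fst_apply (i : Fin 2) :
    AnalyticAt ℂ (fun w : (Fin 2 → ℂ) × (Fin 2 → ℂ) => w.1 i) (0, 0) :=
  ((ContinuousLinearMap.proj (R := ℂ) (φ := fun _ : Fin 2 => ℂ) i).comp
    (ContinuousLinearMap.fst ℂ (Fin 2 → ℂ) (Fin 2 → ℂ))).analyticAt _

lemma analyticAt_snd_apply (i : Fin 2) :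
    AnalyticAt ℂ (fun w : (Fin 2 → ℂ) × (Fin 2 → ℂ) => w.2 i) (0, 0) :=
  ((ContinuousLinearMap.proj (R := ℂ) (φ := fun _ : Fin 2 => ℂ) i).comp
    (ContinuousLinearMap.snd ℂ (Fin 2 → ℂ) (Fin 2 → ℂ))).analyticAt _

/-- The germ at the origin of `ℂ² × ℂ²` of the coordinate `w.1 i`. -/
noncomputable def coord₁ (i : Fin 2) : analyticGerms ((Fin 2 → ℂ) × (Fin 2 → ℂ)) (0, 0) :=
  of (fun w => w.1 i) (analyticAt_fst_apply i)

/-- The germ at the origin of `ℂ² × ℂ²` of the coordinate `w.2 i`. -/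
noncomputable def coord₂ (i : Fin 2) : analyticGerms ((Fin 2 → ℂ) × (Fin 2 → ℂ)) (0, 0) :=
  of (fun w => w.2 i) (analyticAt_snd_apply i)

local notation "𝔪" => RingHom.ker (eval ((Fin 2 → ℂ) × (Fin 2 → ℂ)) (0, 0))

lemma exists_eq_sum_coord {g : (Fin 2 → ℂ) × (Fin 2 → ℂ) → ℂ} (hg : AnalyticAt ℂ g (0, 0))
    (h0 : g (0, 0) = 0) :
    ∃ a b c d : (Fin 2 → ℂ) × (Fin 2 → ℂ) → ℂ, AnalyticAt ℂ a (0, 0) ∧ AnalyticAt ℂ b (0, 0) ∧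
      AnalyticAt ℂ c (0, 0) ∧ AnalyticAt ℂ d (0, 0) ∧ ∀ᶠ w in 𝓝 (0, 0),
        g w = a w * w.1 0 + b w * w.1 1 + c w * w.2 0 + d w * w.2 1 := by
  obtain ⟨h, hh, hw⟩ := hg.exists_eq_add_apply_sub
  have hv : ∀ v, AnalyticAt ℂ (fun w => h w v) (0, 0) := fun v =>
    ((ContinuousLinearMap.apply ℂ ℂ v).analyticAt _).comp hh
  refine ⟨_, _, _, _, hv (![1, 0], 0), hv (![0, 1], 0), hv (0, ![1, 0]), hv (0, ![0, 1]), ?_⟩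
  filter_upwards [hw] with w hw
  have e : w - (0, 0) = w.1 0 • (![1, 0], 0) + w.1 1 • (![0, 1], 0) + w.2 0 • (0, ![1, 0])
      + w.2 1 • ((0, ![0, 1]) : (Fin 2 → ℂ) × (Fin 2 → ℂ)) := by
    ext i <;> fin_cases i <;> simp
  rw [hw, h0, zero_add]
  rw [e]
  simp only [map_add, map_smul, smul_eq_mul]
  ring

lemma ker_eval_eq_span : 𝔪 = Ideal.span {coord₁ 0, coord₁ 1, coord₂ 0, coord₂ 1} := by
  apply le_antisymm
  · intro γ hγ
    obtain ⟨g, hg, rfl⟩ := exists_of γ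
    obtain ⟨a, b, c, d, ha, hb, hc, hd, h⟩ := exists_eq_sum_coord hg hγ
    have : of g hg = of a ha * coord₁ 0 + of b hb * coord₁ 1 + of c hc * coord₂ 0
        + of d hd * coord₂ 1 := Subtype.ext (Filter.Germ.coe_eq.2 h)
    rw [this]
    refine add_mem (add_mem (add_mem ?_ ?_) ?_) ?_ <;>
    exact Ideal.mul_mem_left _ _ (Ideal.subset_span (by simp))
  · rw [Ideal.span_le]
    rintro t (rfl | rfl | rfl | rfl) <;> rfl

/-- If a function continuous at `0` vanishes on a punctured line through `0` near `0`, it vanishes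
at `0`. -/
lemma eq_zero_of_mul_eq_zero {φ : (Fin 2 → ℂ) × (Fin 2 → ℂ) → ℂ} (hφ : ContinuousAt φ (0, 0))
    (e : Fin 2 → ℂ) (h : ∀ᶠ t : ℂ in 𝓝 0, φ (t • e, t • e) * t = 0) : φ (0, 0) = 0 := by
  have hc : Tendsto (fun t : ℂ => φ (t • e, t • e)) (𝓝[≠] 0) (𝓝 (φ (0, 0))) := by
    have hcont : Continuous fun t : ℂ => (t • e, t • e) := by fun_prop
    have h1 : Tendsto (fun t : ℂ => (t • e, t • e)) (𝓝[≠] 0) (𝓝 (0, 0)) :=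
      (hcont.tendsto' 0 (0, 0) (by simp)).mono_left nhdsWithin_le_nhds
    exact hφ.tendsto.comp h1
  refine tendsto_nhds_unique_of_eventuallyEq hc tendsto_const_nhds ?_
  filter_upwards [h.filter_mono nhdsWithin_le_nhds, self_mem_nhdsWithin] with t ht ht0
  exact (mul_eq_zero.1 ht).resolve_right ht0

/-- A germ vanishing on the diagonal lies in `(x - x', y - y') + 𝔪²`. -/
lemma mem_of_vanishes_on_diagonal {g : (Fin 2 → ℂ) × (Fin 2 → ℂ) → ℂ}
    (hg : AnalyticAt ℂ g (0, 0)) (h : ∀ᶠ p : Fin 2 → ℂ in 𝓝 0, g (p, p) = 0) :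
    of g hg ∈ Ideal.span {coord₁ 0 - coord₂ 0, coord₁ 1 - coord₂ 1} ⊔ 𝔪 ^ 2 := by
  obtain ⟨a, b, c, d, ha, hb, hc, hd, hs⟩ := exists_eq_sum_coord hg h.self_of_nhds
  have hdiag : ∀ e : Fin 2 → ℂ, ∀ᶠ t : ℂ in 𝓝 0,
      a (t • e, t • e) * (t * e 0) + b (t • e, t • e) * (t * e 1) + c (t • e, t • e) * (t * e 0)
        + d (t • e, t • e) * (t * e 1) = 0 := by
    intro e
    have h1 : Tendsto (fun t : ℂ => t • e) (𝓝 0) (𝓝 0) :=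
      (by fun_prop : Continuous fun t : ℂ => t • e).tendsto' 0 0 (by simp)
    have h2 : Tendsto (fun t : ℂ => (t • e, t • e)) (𝓝 0) (𝓝 (0, 0)) := h1.prodMk_nhds h1
    filter_upwards [h1.eventually h, h2.eventually hs] with t k1 k2
    rw [k1] at k2
    simpa using k2.symm
  have hac : (a + c) (0, 0) = 0 := by
    refine eq_zero_of_mul_eq_zero (ha.add hc).continuousAt ![1, 0] ?_
    filter_upwards [hdiag ![1, 0]] with t ht
    simp [-mul_eq_zero] at ht ⊢
    linear_combination ht
  have hbd : (b + d) (0, 0) = 0 := by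
    refine eq_zero_of_mul_eq_zero (hb.add hd).continuousAt ![0, 1] ?_
    filter_upwards [hdiag ![0, 1]] with t ht
    simp [-mul_eq_zero] at ht ⊢
    linear_combination ht
  have e : of g hg = (of a ha * (coord₁ 0 - coord₂ 0) + of b hb * (coord₁ 1 - coord₂ 1))
      + ((of a ha + of c hc) * coord₂ 0 + (of b hb + of d hd) * coord₂ 1) := by
    have : of g hg = of a ha * coord₁ 0 + of b hb * coord₁ 1 + of c hc * coord₂ 0
        + of d hd * coord₂ 1 := Subtype.ext (Filter.Germ.coe_eq.2 hs)
    rw [this]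
    ring
  rw [e]
  refine add_mem (Ideal.mem_sup_left (add_mem ?_ ?_)) (Ideal.mem_sup_right (add_mem ?_ ?_))
  · exact Ideal.mul_mem_left _ _ (Ideal.subset_span (by simp))
  · exact Ideal.mul_mem_left _ _ (Ideal.subset_span (by simp))
  · rw [pow_two]
    exact Ideal.mul_mem_mul hac rfl
  · rw [pow_two]
    exact Ideal.mul_mem_mul hbd rfl

/-- On the diagonal, the coefficients of a relation `β₀ (x - x') + β₁ (y - y') = 0` vanish. -/
lemma vanishes_on_diagonal_of_relation {β : Fin 2 → (Fin 2 → ℂ) × (Fin 2 → ℂ) → ℂ}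
    (hβ : ∀ i, AnalyticAt ℂ (β i) (0, 0))
    (h : ∀ᶠ w : (Fin 2 → ℂ) × (Fin 2 → ℂ) in 𝓝 (0, 0), ∑ i, β i w * (w.1 i - w.2 i) = 0)
    (i : Fin 2) : ∀ᶠ p : Fin 2 → ℂ in 𝓝 0, β i (p, p) = 0 := by
  have h1 : Tendsto (fun p : Fin 2 → ℂ => (p, p)) (𝓝 0) (𝓝 (0, 0)) :=
    tendsto_id.prodMk_nhds tendsto_id
  filter_upwards [h1.eventually h.eventually_nhds,
    h1.eventually (hβ i).eventually_analyticAt] with p hp ha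
  have h2 : Tendsto (fun t : ℂ => (p + t • Pi.single i 1, p)) (𝓝[≠] 0) (𝓝 (p, p)) :=
    ((by fun_prop : Continuous fun t : ℂ => (p + t • Pi.single i (1 : ℂ), p)).tendsto' 0 (p, p)
      (by simp)).mono_left nhdsWithin_le_nhds
  refine tendsto_nhds_unique_of_eventuallyEq (ha.continuousAt.tendsto.comp h2)
    tendsto_const_nhds ?_
  filter_upwards [h2.eventually hp, self_mem_nhdsWithin] with t ht ht0
  have : β i (p + t • Pi.single i 1, p) * t = 0 := by
    simpa [Pi.single_apply] using ht
  exact (mul_eq_zero.1 this).resolve_right ht0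

/-- A matrix of polynomials writing `f(w.1) - f(w.2)` as a combination of the coordinates of
`w.1 - w.2`, for `f(x, y) = (x², y², x³ + xy, y³ + xy)`. -/
noncomputable def modelMatrix : Fin 4 → Fin 2 → (Fin 2 → ℂ) × (Fin 2 → ℂ) → ℂ :=
  ![![fun w => w.1 0 + w.2 0, fun _ => 0],
    ![fun _ => 0, fun w => w.1 1 + w.2 1],
    ![fun w => w.1 0 ^ 2 + w.1 0 * w.2 0 + w.2 0 ^ 2 + w.1 1, fun w => w.2 0],
    ![fun w => w.1 1, fun w => w.1 1 ^ 2 + w.1 1 * w.2 1 + w.2 1 ^ 2 + w.2 0]]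

lemma analyticAt_modelMatrix (j : Fin 4) (i : Fin 2) :
    AnalyticAt ℂ (modelMatrix j i) (0, 0) := by
  have h1 := analyticAt_fst_apply
  have h2 := analyticAt_snd_apply
  fin_cases j <;> fin_cases i
  · exact (h1 0).add (h2 0)
  · exact analyticAt_const
  · exact analyticAt_const
  · exact (h1 1).add (h2 1)
  · exact ((((h1 0).pow 2).add ((h1 0).mul (h2 0))).add ((h2 0).pow 2)).add (h1 1)
  · exact h2 0
  · exact h1 1
  · exact ((((h1 1).pow 2).add ((h1 1).mul (h2 1))).add ((h2 1).pow 2)).add (h2 0)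

lemma modelMatrix_zero (j : Fin 4) (i : Fin 2) : modelMatrix j i (0, 0) = 0 := by
  fin_cases j <;> fin_cases i <;> simp [modelMatrix]

variable {f : (Fin 2 → ℂ) → (Fin 4 → ℂ)} {α : Fin 4 → Fin 2 → ((Fin 2 → ℂ) × (Fin 2 → ℂ)) → ℂ}

lemma sub_eq_sum_modelMatrix
    (hf : ∀ x : Fin 2 → ℂ,
      f x = ![(x 0) ^ 2, (x 1) ^ 2, (x 0) ^ 3 + x 0 * x 1, (x 1) ^ 3 + x 0 * x 1])
    (w : (Fin 2 → ℂ) × (Fin 2 → ℂ)) (j : Fin 4) :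
    f w.1 j - f w.2 j = ∑ i, modelMatrix j i w * (w.1 i - w.2 i) := by
  rw [hf, hf, Fin.sum_univ_two]
  fin_cases j <;> simp [modelMatrix] <;> ring

lemma eventually_eq_modelMatrix_on_diagonal
    (hf : ∀ x : Fin 2 → ℂ,
      f x = ![(x 0) ^ 2, (x 1) ^ 2, (x 0) ^ 3 + x 0 * x 1, (x 1) ^ 3 + x 0 * x 1])
    (hα : ∀ j i, AnalyticAt ℂ (α j i) (0, 0))
    (hrel : ∀ᶠ w : (Fin 2 → ℂ) × (Fin 2 → ℂ) in nhds (0, 0),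
      ∀ j, f w.1 j - f w.2 j = ∑ i, α j i w * (w.1 i - w.2 i)) (j : Fin 4) (i : Fin 2) :
    ∀ᶠ p : Fin 2 → ℂ in 𝓝 0, (α j i - modelMatrix j i) (p, p) = 0 := by
  refine vanishes_on_diagonal_of_relation (β := fun i => α j i - modelMatrix j i)
    (fun i => (hα j i).sub (analyticAt_modelMatrix j i)) ?_ i
  filter_upwards [hrel] with w hw
  simp only [Pi.sub_apply, sub_mul, Finset.sum_sub_distrib, ← hw j, ← sub_eq_sum_modelMatrix hf,
    sub_self]

lemma of_sub_modelMatrix_mem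
    (hf : ∀ x : Fin 2 → ℂ,
      f x = ![(x 0) ^ 2, (x 1) ^ 2, (x 0) ^ 3 + x 0 * x 1, (x 1) ^ 3 + x 0 * x 1])
    (hα : ∀ j i, AnalyticAt ℂ (α j i) (0, 0))
    (hrel : ∀ᶠ w : (Fin 2 → ℂ) × (Fin 2 → ℂ) in nhds (0, 0),
      ∀ j, f w.1 j - f w.2 j = ∑ i, α j i w * (w.1 i - w.2 i)) (j : Fin 4) (i : Fin 2) :
    of (α j i) (hα j i) - of (modelMatrix j i) (analyticAt_modelMatrix j i) ∈
      Ideal.span {coord₁ 0 - coord₂ 0, coord₁ 1 - coord₂ 1} ⊔ 𝔪 ^ 2 :=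
  mem_of_vanishes_on_diagonal ((hα j i).sub (analyticAt_modelMatrix j i))
    (eventually_eq_modelMatrix_on_diagonal hf hα hrel j i)

lemma coord₁_mem (i : Fin 2) : coord₁ i ∈ 𝔪 := rfl

lemma coord₂_mem (i : Fin 2) : coord₂ i ∈ 𝔪 := rfl

lemma minor_mem_mondDoubleIdeal (hα : ∀ j i, AnalyticAt ℂ (α j i) (0, 0)) {j k : Fin 4}
    (hjk : j < k) :
    of (α j 0) (hα j 0) * of (α k 1) (hα k 1) - of (α j 1) (hα j 1) * of (α k 0) (hα k 0) ∈
      mondDoubleIdeal 2 4 f α := by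
  refine Ideal.subset_span (Or.inr ⟨![j, k], ?_, ?_⟩)
  · intro a b hab
    fin_cases a <;> fin_cases b <;> simp_all
  · simp only [Matrix.det_fin_two, Matrix.of_apply]
    rfl

/-- The double point ideal lies in `𝔪²`. -/
lemma mondDoubleIdeal_le_sq
    (hf : ∀ x : Fin 2 → ℂ,
      f x = ![(x 0) ^ 2, (x 1) ^ 2, (x 0) ^ 3 + x 0 * x 1, (x 1) ^ 3 + x 0 * x 1])
    (hα : ∀ j i, AnalyticAt ℂ (α j i) (0, 0))
    (hrel : ∀ᶠ w : (Fin 2 → ℂ) × (Fin 2 → ℂ) in nhds (0, 0),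
      ∀ j, f w.1 j - f w.2 j = ∑ i, α j i w * (w.1 i - w.2 i)) :
    mondDoubleIdeal 2 4 f α ≤ 𝔪 ^ 2 := by
  have hα0 : ∀ j i, of (α j i) (hα j i) ∈ 𝔪 := by
    intro j i
    have h : α j i (0, 0) - modelMatrix j i (0, 0) = 0 :=
      (eventually_eq_modelMatrix_on_diagonal hf hα hrel j i).self_of_nhds
    rwa [modelMatrix_zero, sub_zero] at h
  refine Ideal.span_le.2 ?_
  rw [pow_two]
  rintro γ (⟨j, hj⟩ | ⟨rows, -, hrows⟩)
  · have : γ = of (α j 0) (hα j 0) * (coord₁ 0 - coord₂ 0)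
        + of (α j 1) (hα j 1) * (coord₁ 1 - coord₂ 1) := by
      refine Subtype.ext (hj.trans (Filter.Germ.coe_eq.2 ?_))
      filter_upwards [hrel] with w hw
      rw [hw j, Fin.sum_univ_two]
    rw [this]
    exact add_mem (Ideal.mul_mem_mul (hα0 _ _) (sub_mem (coord₁_mem _) (coord₂_mem _)))
      (Ideal.mul_mem_mul (hα0 _ _) (sub_mem (coord₁_mem _) (coord₂_mem _)))
  · have : γ = of (α (rows 0) 0) (hα _ _) * of (α (rows 1) 1) (hα _ _)
        - of (α (rows 0) 1) (hα _ _) * of (α (rows 1) 0) (hα _ _) := by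
      refine Subtype.ext (hrows.trans ?_)
      simp only [Matrix.det_fin_two, Matrix.of_apply]
      rfl
    rw [this]
    exact sub_mem (Ideal.mul_mem_mul (hα0 _ _) (hα0 _ _))
      (Ideal.mul_mem_mul (hα0 _ _) (hα0 _ _))

/-- The maximal ideal is the only prime containing the double point ideal. -/
lemma eq_ker_eval_of_mondDoubleIdeal_le
    (hf : ∀ x : Fin 2 → ℂ,
      f x = ![(x 0) ^ 2, (x 1) ^ 2, (x 0) ^ 3 + x 0 * x 1, (x 1) ^ 3 + x 0 * x 1])
    (hα : ∀ j i, AnalyticAt ℂ (α j i) (0, 0))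
    (hrel : ∀ᶠ w : (Fin 2 → ℂ) × (Fin 2 → ℂ) in nhds (0, 0),
      ∀ j, f w.1 j - f w.2 j = ∑ i, α j i w * (w.1 i - w.2 i))
    {P : Ideal (analyticGerms ((Fin 2 → ℂ) × (Fin 2 → ℂ)) (0, 0))} [P.IsPrime]
    (hP : mondDoubleIdeal 2 4 f α ≤ P) : P = 𝔪 := by
  refine le_antisymm (le_ker_eval Ideal.IsPrime.ne_top') ?_
  have hfm : ∀ (j : Fin 4) (γ : analyticGerms ((Fin 2 → ℂ) × (Fin 2 → ℂ)) (0, 0)),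
      (γ : Filter.Germ (𝓝 ((0, 0) : (Fin 2 → ℂ) × (Fin 2 → ℂ))) ℂ)
        = ((fun w : (Fin 2 → ℂ) × (Fin 2 → ℂ) => f w.1 j - f w.2 j) :
          Filter.Germ (𝓝 ((0, 0) : (Fin 2 → ℂ) × (Fin 2 → ℂ))) ℂ) → γ ∈ P :=
    fun j γ h => hP (Ideal.subset_span (Or.inl ⟨j, h⟩))
  have hmem := of_sub_modelMatrix_mem hf hα hrel
  have hJ : ∀ i : Fin 2, coord₁ i - coord₂ i ∈
      Ideal.span {coord₁ 0 - coord₂ 0, coord₁ 1 - coord₂ 1} ⊔ 𝔪 ^ 2 := by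
    intro i
    refine Ideal.mem_sup_left (Ideal.subset_span ?_)
    fin_cases i <;> simp
  have hsq : ∀ {s t : analyticGerms ((Fin 2 → ℂ) × (Fin 2 → ℂ)) (0, 0)}, s ∈ 𝔪 → t ∈ 𝔪 →
      s * t ∈ Ideal.span {coord₁ 0 - coord₂ 0, coord₁ 1 - coord₂ 1} ⊔ 𝔪 ^ 2 := by
    intro s t hs ht
    rw [pow_two]
    exact Ideal.mem_sup_right (Ideal.mul_mem_mul hs ht)
  have h2 : IsUnit (2 : analyticGerms ((Fin 2 → ℂ) × (Fin 2 → ℂ)) (0, 0)) := by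
    apply isUnit_of_eval_ne_zero
    rw [map_ofNat]
    exact two_ne_zero
  have e00 : of (modelMatrix 0 0) (analyticAt_modelMatrix 0 0) = coord₁ 0 + coord₂ 0 := rfl
  have e01 : of (modelMatrix 0 1) (analyticAt_modelMatrix 0 1) = 0 := rfl
  have e10 : of (modelMatrix 1 0) (analyticAt_modelMatrix 1 0) = 0 := rfl
  have e11 : of (modelMatrix 1 1) (analyticAt_modelMatrix 1 1) = coord₁ 1 + coord₂ 1 := rfl
  have e20 : of (modelMatrix 2 0) (analyticAt_modelMatrix 2 0) =
    coord₁ 0 ^ 2 + coord₁ 0 * coord₂ 0 + coord₂ 0 ^ 2 + coord₁ 1 := rfl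
  have e21 : of (modelMatrix 2 1) (analyticAt_modelMatrix 2 1) = coord₂ 0 := rfl
  refine le_of_double_point_equations_mem ker_eval_le_jacobson h2 ker_eval_eq_span
    (hfm 0 _ ?_) (hfm 1 _ ?_) (hfm 2 _ ?_) (hfm 3 _ ?_) (a := of (α 0 0) (hα 0 0))
    (b := of (α 0 1) (hα 0 1)) (c := of (α 1 0) (hα 1 0)) (d := of (α 1 1) (hα 1 1))
    (e := of (α 2 0) (hα 2 0)) (g := of (α 2 1) (hα 2 1)) ?_ ?_ ?_ ?_ ?_ ?_
    (hP (minor_mem_mondDoubleIdeal hα (by decide)))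
    (hP (minor_mem_mondDoubleIdeal hα (by decide)))
    (hP (minor_mem_mondDoubleIdeal hα (by decide)))
  · simp only [hf]; rfl
  · simp only [hf]; rfl
  · simp only [hf]; rfl
  · simp only [hf]; rfl
  · have h := hmem 0 0
    rw [e00] at h
    convert sub_mem h (hJ 0) using 1
    ring
  · simpa [e01] using hmem 0 1
  · simpa [e10] using hmem 1 0
  · have h := hmem 1 1
    rw [e11] at h
    convert sub_mem h (hJ 1) using 1
    ring
  · have h := hmem 2 0
    rw [e20] at h
    convert add_mem h (add_mem (add_mem (hsq (coord₁_mem 0) (coord₁_mem 0))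
      (hsq (coord₁_mem 0) (coord₂_mem 0))) (hsq (coord₂_mem 0) (coord₂_mem 0))) using 1
    ring
  · have h := hmem 2 1
    rw [e21] at h
    convert sub_mem h (hJ 0) using 1
    ring

end Plane

end analyticGerms

/-- For `f : (ℂ²,0) → (ℂ⁴,0)`, `f(x,y) = (x², y², x³ + xy, y³ + xy)`, the double point
space `D²(f) = V(I²(f))` has (Krull) dimension `0` but embedding dimension `4` (i.e.
`2n` minus the dimension of the space of linear parts of `I²(f)` is `4`); consequently
`D²(f)` is a non-reduced scheme. -/
theorem doublePointSpace_dim_zero_edim_four_nonreduced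
    (f : (Fin 2 → ℂ) → (Fin 4 → ℂ))
    (hf : ∀ x : Fin 2 → ℂ,
      f x = ![(x 0) ^ 2, (x 1) ^ 2, (x 0) ^ 3 + x 0 * x 1, (x 1) ^ 3 + x 0 * x 1])
    (α : Fin 4 → Fin 2 → ((Fin 2 → ℂ) × (Fin 2 → ℂ)) → ℂ)
    (hα : ∀ j i, AnalyticAt ℂ (α j i) (0, 0))
    (hrel : ∀ᶠ w : (Fin 2 → ℂ) × (Fin 2 → ℂ) in nhds (0, 0),
      ∀ j, f w.1 j - f w.2 j = ∑ i, α j i w * (w.1 i - w.2 i)) :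
    ringKrullDim ((analyticGerms ((Fin 2 → ℂ) × (Fin 2 → ℂ)) (0, 0)) ⧸
        mondDoubleIdeal 2 4 f α) = (0 : ℕ) ∧
    (2 * 2 : ℤ) - Module.finrank ℂ (linearParts 2 (mondDoubleIdeal 2 4 f α)) = 4 ∧
    ¬ IsReduced ((analyticGerms ((Fin 2 → ℂ) × (Fin 2 → ℂ)) (0, 0)) ⧸
        mondDoubleIdeal 2 4 f α) := by
  have hle := analyticGerms.mondDoubleIdeal_le_sq hf hα hrel
  have hne : mondDoubleIdeal 2 4 f α ≠ ⊤ := by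
    intro h
    exact analyticGerms.isMaximal_ker_eval.ne_top
      (top_le_iff.1 ((h ▸ hle).trans (Ideal.pow_le_self two_ne_zero)))
  have : Nontrivial (analyticGerms ((Fin 2 → ℂ) × (Fin 2 → ℂ)) (0, 0) ⧸
      mondDoubleIdeal 2 4 f α) := Ideal.Quotient.nontrivial_iff.2 hne
  refine ⟨?_, ?_, ?_⟩
  · rw [Nat.cast_zero, ← ringKrullDimZero_iff_ringKrullDim_eq_zero, Ring.krullDimLE_zero_iff]
    intro J hJ
    have hker : mondDoubleIdeal 2 4 f α ≤ J.comap (Ideal.Quotient.mk _) := by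
      intro γ hγ
      rw [Ideal.mem_comap, Ideal.Quotient.eq_zero_iff_mem.2 hγ]
      exact J.zero_mem
    have hcomap := analyticGerms.eq_ker_eval_of_mondDoubleIdeal_le hf hα hrel hker
    have hsurj := Ideal.Quotient.mk_surjective (I := mondDoubleIdeal 2 4 f α)
    have hmap := Ideal.map_comap_of_surjective _ hsurj J
    have hmax := Ideal.map_eq_top_or_isMaximal_of_surjective _ hsurj
      analyticGerms.isMaximal_ker_eval
    rw [← hcomap, hmap] at hmax
    exact hmax.resolve_left hJ.ne_top
  · have : linearParts 2 (mondDoubleIdeal 2 4 f α) = ⊥ := by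
      refine Submodule.span_eq_bot.2 ?_
      rintro L ⟨γ, hγ, g, -, hg, rfl⟩
      exact analyticGerms.fderiv_eq_zero_of_mem_sq (hle hγ) hg
    rw [this, finrank_bot]
    norm_num
  · intro hred
    have hrad := (Ideal.isRadical_iff_quotient_reduced _).2 hred
    have hx : analyticGerms.coord₁ 0 ∈ mondDoubleIdeal 2 4 f α := by
      apply hrad
      rw [Ideal.radical_eq_sInf, Ideal.mem_sInf]
      rintro P ⟨hP, hprime⟩
      rw [analyticGerms.eq_ker_eval_of_mondDoubleIdeal_le hf hα hrel hP]
      exact analyticGerms.coord₁_mem 0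
    have hd := analyticGerms.fderiv_eq_zero_of_mem_sq (hle hx) (g := fun w => w.1 0) rfl
    have hL := ((ContinuousLinearMap.proj (R := ℂ) (φ := fun _ : Fin 2 => ℂ) 0).comp
      (ContinuousLinearMap.fst ℂ (Fin 2 → ℂ) (Fin 2 → ℂ))).hasFDerivAt (x := (0, 0))
    have := congrArg (fun L => L (fun _ => 1, 0)) (hL.fderiv.symm.trans hd)
    simp at this
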